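/- Let (W,S) be a Coxeter system, let T, T' ⊆ S with the standard parabolic subgroup W_T finite, and let E = gW_T and F = hW_{T'} be left cosets. Let E' = ⋃_{x ∈ E} Proj(x,F). If v_1, v_2 ∈ W satisfy Proj(v_1,E) = Proj(v_2,E), then Proj(v_1,E') = Proj(v_2,E'). -/

import Mathlib

/-!
Some constructions attached to a Coxeter system `cs : CoxeterSystem M W`: the word distance
`d(u,v) = ℓ(u⁻¹ v)`, distances between subsets, the nearest-point projection of one coset onto
another, and standard parabolic subgroups.
-/

open Pointwise

namespace CoxAux

variable {B : Type*} {W : Type*} [Group W] {M : CoxeterMatrix B}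

/-- The distance `d(u,v) = ℓ(u⁻¹ v)` on `W` induced by the Coxeter length function. -/
noncomputable def dist (cs : CoxeterSystem M W) (u v : W) : ℕ :=
  cs.length (u⁻¹ * v)

/-- The distance between two subsets of `W`: the least distance between a point of `X` and a
point of `Y`. -/
noncomputable def setDist (cs : CoxeterSystem M W) (X Y : Set W) : ℕ :=
  sInf { n | ∃ x ∈ X, ∃ y ∈ Y, dist cs x y = n }

/-- The projection `Π_C(C') = {x ∈ C : d(x, C') = d(C, C')}` of `C'` onto `C`. -/
noncomputable def projSet (cs : CoxeterSystem M W) (C C' : Set W) : Set W :=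
  { x ∈ C | setDist cs {x} C' = setDist cs C C' }

/-- The standard parabolic subgroup `W_ŝ` generated by the simple reflections other than
`s`. -/
def parabHat (cs : CoxeterSystem M W) (s : B) : Subgroup W :=
  Subgroup.closure { w | ∃ t : B, t ≠ s ∧ w = cs.simple t }

/-- The support of a subset `X ⊆ W`: the set of `s ∈ S` such that some `u ∈ X` satisfies
`u s ∈ X`. -/
def supp (cs : CoxeterSystem M W) (X : Set W) : Set B :=
  { s : B | ∃ u ∈ X, u * cs.simple s ∈ X }

end CoxAux

open CoxAux

/-- The set of points of `C` nearest to `v`: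
`Proj(v, C) = {p ∈ C : ∀ q ∈ C, d(v,p) ≤ d(v,q)}`. -/
noncomputable def nearestPoints {B : Type*} {W : Type*} [Group W] {M : CoxeterMatrix B}
    (cs : CoxeterSystem M W) (v : W) (C : Set W) : Set W :=
  { p ∈ C | ∀ q ∈ C, dist cs v p ≤ dist cs v q }

theorem Finset.card_symmDiff_le_of_agree {α : Type*} [DecidableEq α] {V₁ V₂ Y Y' : Finset α}
    (h : ∀ t ∈ symmDiff Y Y', t ∈ V₁ ↔ t ∈ V₂)
    (hle : (symmDiff V₁ Y).card ≤ (symmDiff V₁ Y').card) :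
    (symmDiff V₂ Y).card ≤ (symmDiff V₂ Y').card := by
  have h₁ : symmDiff V₁ Y \ symmDiff Y Y' = symmDiff V₁ Y' \ symmDiff Y Y' := by
    ext t; simp only [Finset.mem_sdiff, Finset.mem_symmDiff]; tauto
  have h₂ : symmDiff V₂ Y \ symmDiff Y Y' = symmDiff V₂ Y' \ symmDiff Y Y' := by
    ext t; simp only [Finset.mem_sdiff, Finset.mem_symmDiff]; tauto
  have h₃ (Z : Finset α) :
      symmDiff V₁ Z ∩ symmDiff Y Y' = symmDiff V₂ Z ∩ symmDiff Y Y' := by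
    ext t
    have := h t
    simp only [Finset.mem_inter, Finset.mem_symmDiff] at this ⊢
    tauto
  have e₁ := Finset.card_sdiff_add_card_inter (symmDiff V₁ Y) (symmDiff Y Y')
  have e₂ := Finset.card_sdiff_add_card_inter (symmDiff V₁ Y') (symmDiff Y Y')
  have e₃ := Finset.card_sdiff_add_card_inter (symmDiff V₂ Y) (symmDiff Y Y')
  have e₄ := Finset.card_sdiff_add_card_inter (symmDiff V₂ Y') (symmDiff Y Y')
  rw [h₁, h₃] at e₁
  rw [h₃] at e₂
  rw [h₂] at e₃
  omega

namespace CoxeterSystem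

open Classical

variable {B : Type*} {W : Type*} [Group W] {M : CoxeterMatrix B} (cs : CoxeterSystem M W)

/-- The action of a simple reflection on signed elements: conjugate, and flip the sign at the
simple reflection itself. -/
noncomputable def signedConj (i : B) : Function.End (W × ZMod 2) :=
  fun p ↦ (cs.simple i * p.1 * cs.simple i, p.2 + if p.1 = cs.simple i then 1 else 0)

theorem signedConj_mul_pow (i j : B) (k : ℕ) (t : W) (ε : ZMod 2) :
    ((cs.signedConj i * cs.signedConj j) ^ k) (t, ε) =
      ((cs.simple i * cs.simple j) ^ k * t * ((cs.simple i * cs.simple j) ^ k)⁻¹,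
        ε + ∑ l ∈ Finset.range (2 * k),
          if (cs.simple i * cs.simple j) ^ l * t = cs.simple j then 1 else 0) := by
  set r := cs.simple i * cs.simple j with hr
  have hsr (k : ℕ) : cs.simple j * r ^ k = (r ^ k)⁻¹ * cs.simple j := by
    have : r⁻¹ = cs.simple j * r * (cs.simple j)⁻¹ := by simp [hr, mul_assoc]
    rw [← inv_pow, this, conj_pow]
    simp [mul_assoc]
  have hrr (k l : ℕ) : r ^ k * t * (r ^ k)⁻¹ = (r ^ l)⁻¹ * cs.simple j ↔
      r ^ (2 * k + l) * t = cs.simple j := by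
    rw [mul_inv_eq_iff_eq_mul, mul_assoc _ (cs.simple j), hsr, ← mul_assoc, ← mul_inv_rev,
      ← pow_add, eq_inv_mul_iff_mul_eq, ← mul_assoc, ← pow_add]
    rw [show k + l + k = 2 * k + l by ring]
  induction k with
  | zero => simp [Function.End.one_def]
  | succ k ih =>
    rw [pow_succ']
    change cs.signedConj i (cs.signedConj j (((cs.signedConj i * cs.signedConj j) ^ k) (t, ε))) = _
    rw [ih]
    have h₀ := hrr k 0
    have h₁ := hrr k 1
    have h₂ : cs.simple j * (r ^ k * t * (r ^ k)⁻¹) * cs.simple j = cs.simple i ↔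
        r ^ k * t * (r ^ k)⁻¹ = (r ^ 1)⁻¹ * cs.simple j := by
      rw [← eq_mul_inv_iff_mul_eq, ← eq_inv_mul_iff_mul_eq]
      simp [hr, mul_assoc]
    simp only [pow_zero, inv_one, one_mul, add_zero] at h₀
    simp only [signedConj, h₂, h₁, h₀, mul_add_one, Finset.sum_range_succ, Prod.mk.injEq]
    refine ⟨by simp [pow_succ', hr, mul_assoc], by ring⟩

theorem isLiftable_signedConj : M.IsLiftable cs.signedConj := by
  intro i j
  funext ⟨t, ε⟩
  rw [signedConj_mul_pow, two_mul, Finset.sum_range_add]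
  simp only [pow_add, cs.simple_mul_simple_pow i j, one_mul, CharTwo.add_self_eq_zero]
  simp [Function.End.one_def]

/-- Whether the wall of `t` separates `1` from `w`, as an element of `ZMod 2`. -/
noncomputable def inversionParity (w t : W) : ZMod 2 :=
  (cs.lift ⟨cs.signedConj, cs.isLiftable_signedConj⟩ w⁻¹ (t, 0)).2

theorem lift_signedConj_apply (w t : W) (ε : ZMod 2) :
    cs.lift ⟨cs.signedConj, cs.isLiftable_signedConj⟩ w (t, ε) =
      (w * t * w⁻¹, ε + cs.inversionParity w⁻¹ t) := by
  simp only [inversionParity, inv_inv]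
  induction w using cs.simple_induction_left generalizing t ε with
  | one => simp [Function.End.one_def]
  | mul_simple_left w i ih =>
    have key (ε : ZMod 2) :
        cs.lift ⟨cs.signedConj, cs.isLiftable_signedConj⟩ (cs.simple i * w) (t, ε) =
        cs.signedConj i (cs.lift ⟨cs.signedConj, cs.isLiftable_signedConj⟩ w (t, ε)) := by
      rw [map_mul, lift_apply_simple]; rfl
    rw [key, key, ih, ih t 0]
    simp [signedConj, mul_assoc, add_assoc]

theorem inversionParity_mul (u w t : W) :
    cs.inversionParity (u * w) t =
      cs.inversionParity u t + cs.inversionParity w (u⁻¹ * t * u) := by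
  have h : cs.lift ⟨cs.signedConj, cs.isLiftable_signedConj⟩ (u * w)⁻¹ (t, 0) =
      cs.lift ⟨cs.signedConj, cs.isLiftable_signedConj⟩ w⁻¹
        (cs.lift ⟨cs.signedConj, cs.isLiftable_signedConj⟩ u⁻¹ (t, 0)) := by
    rw [mul_inv_rev, map_mul]; rfl
  have h' := congrArg Prod.snd h
  rw [lift_signedConj_apply, lift_signedConj_apply, lift_signedConj_apply] at h'
  simpa using h'

theorem inversionParity_simple (i : B) (t : W) :
    cs.inversionParity (cs.simple i) t = if t = cs.simple i then 1 else 0 := by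
  simp [inversionParity, lift_apply_simple, signedConj]

@[simp] theorem inversionParity_one (t : W) : cs.inversionParity 1 t = 0 := by
  simp [inversionParity, Function.End.one_def]

theorem inversionParity_wordProd (ω : List B) (t : W) :
    cs.inversionParity (cs.wordProd ω) t = ((cs.leftInvSeq ω).count t : ZMod 2) := by
  induction ω generalizing t with
  | nil => simp
  | cons i ω ih =>
    have h := List.count_map_of_injective (cs.leftInvSeq ω) (MulAut.conj (cs.simple i))
      (MulAut.conj (cs.simple i)).injective (cs.simple i * t * cs.simple i)
    have h' : MulAut.conj (cs.simple i) (cs.simple i * t * cs.simple i) = t := by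
      simp [mul_assoc]
    rw [h'] at h
    rw [wordProd_cons, inversionParity_mul, inversionParity_simple, ih, inv_simple, ← h,
      leftInvSeq, List.count_cons]
    simp only [beq_iff_eq, eq_comm (a := cs.simple i), Nat.cast_add, Nat.cast_ite, Nat.cast_one,
      Nat.cast_zero, add_comm]

/-- The left inversions of `w`: the reflections whose walls separate `1` from `w`. -/
noncomputable def leftInversions (w : W) : Finset W :=
  (cs.leftInvSeq (cs.exists_isReduced w).choose).toFinset

theorem card_leftInversions (w : W) : (cs.leftInversions w).card = cs.length w := by
  obtain ⟨hred, hw⟩ := (cs.exists_isReduced w).choose_spec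
  rw [leftInversions, List.toFinset_card_of_nodup hred.nodup_leftInvSeq, length_leftInvSeq,
    ← hred.eq, ← hw]

theorem inversionParity_eq_ite (w t : W) :
    cs.inversionParity w t = if t ∈ cs.leftInversions w then 1 else 0 := by
  obtain ⟨hred, hw⟩ := (cs.exists_isReduced w).choose_spec
  conv_lhs => rw [hw]
  rw [inversionParity_wordProd, hred.nodup_leftInvSeq.count, leftInversions]
  simp

theorem length_mul_lt_of_mem_leftInversions {w t : W} (ht : t ∈ cs.leftInversions w) :
    cs.length (t * w) < cs.length w := by
  obtain ⟨hred, hw⟩ := (cs.exists_isReduced w).choose_spec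
  have := (cs.isLeftInversion_of_mem_leftInvSeq hred (List.mem_toFinset.mp ht)).2
  rwa [← hw] at this

theorem mem_leftInversions_inv_mul_iff (a b t : W) :
    a⁻¹ * t * a ∈ cs.leftInversions (a⁻¹ * b) ↔
      t ∈ symmDiff (cs.leftInversions a) (cs.leftInversions b) := by
  have h := cs.inversionParity_mul a (a⁻¹ * b) t
  rw [mul_inv_cancel_left, inversionParity_eq_ite, inversionParity_eq_ite,
    inversionParity_eq_ite] at h
  rw [Finset.mem_symmDiff]
  by_cases h₁ : t ∈ cs.leftInversions a <;> by_cases h₂ : t ∈ cs.leftInversions b <;>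
    by_cases h₃ : a⁻¹ * t * a ∈ cs.leftInversions (a⁻¹ * b) <;>
    simp [h₁, h₂, h₃] at h ⊢

theorem dist_eq_card_symmDiff (a b : W) :
    CoxAux.dist cs a b = (symmDiff (cs.leftInversions a) (cs.leftInversions b)).card := by
  rw [CoxAux.dist, ← card_leftInversions,
    ← Finset.card_map (MulAut.conj a).toEquiv.toEmbedding]
  congr 1
  ext t
  rw [← mem_leftInversions_inv_mul_iff, Finset.mem_map_equiv]
  change (MulAut.conj a).symm t ∈ _ ↔ _
  rw [MulAut.conj_symm_apply]

theorem mem_closure_of_mem_leftInversions {T : Set B} {w t : W}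
    (hw : w ∈ Subgroup.closure (cs.simple '' T)) (ht : t ∈ cs.leftInversions w) :
    t ∈ Subgroup.closure (cs.simple '' T) := by
  have hne : cs.inversionParity w t ≠ 0 := by simp [inversionParity_eq_ite, ht]
  clear ht
  induction hw using Subgroup.closure_induction generalizing t with
  | mem x hx =>
    obtain ⟨i, hi, rfl⟩ := hx
    rw [inversionParity_simple] at hne
    obtain rfl : t = cs.simple i := by by_contra h; simp [h] at hne
    exact Subgroup.subset_closure ⟨i, hi, rfl⟩
  | one => simp at hne
  | mul x y hx hy ihx ihy =>
    by_cases h : cs.inversionParity x t = 0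
    · rw [inversionParity_mul, h, zero_add] at hne
      simpa [mul_assoc] using mul_mem (mul_mem hx (ihy hne)) (inv_mem hx)
    · exact ihx h
  | inv x hx ih =>
    have h := cs.inversionParity_mul x⁻¹ x t
    rw [inv_mul_cancel, inversionParity_one, inv_inv] at h
    have h' : cs.inversionParity x (x * t * x⁻¹) ≠ 0 := by
      intro h0
      rw [h0, add_zero] at h
      exact hne h.symm
    simpa [mul_assoc] using mul_mem (mul_mem (inv_mem hx) (ih h')) hx

/-- A wall separating two points of a coset `g W_T` does not separate a point from its nearest
points in that coset. -/
theorem mem_leftInversions_iff_of_mem_nearestPoints {T : Set B} {g v p a b t : W}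
    (ha : a ∈ g • (Subgroup.closure (cs.simple '' T) : Set W))
    (hb : b ∈ g • (Subgroup.closure (cs.simple '' T) : Set W))
    (hp : p ∈ nearestPoints cs v (g • (Subgroup.closure (cs.simple '' T) : Set W)))
    (ht : t ∈ symmDiff (cs.leftInversions a) (cs.leftInversions b)) :
    t ∈ cs.leftInversions v ↔ t ∈ cs.leftInversions p := by
  by_contra hne
  have htv : t ∈ symmDiff (cs.leftInversions v) (cs.leftInversions p) := by
    rw [Finset.mem_symmDiff]; tauto
  rw [← mem_leftInversions_inv_mul_iff] at ht htv
  have hlt := cs.length_mul_lt_of_mem_leftInversions htv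
  obtain ⟨hpC, hmin⟩ := hp
  rw [Set.mem_smul_set_iff_inv_smul_mem, SetLike.mem_coe, smul_eq_mul] at ha hb hpC
  have hab : a⁻¹ * b ∈ Subgroup.closure (cs.simple '' T) := by
    simpa [mul_assoc] using mul_mem (inv_mem ha) hb
  have hta := cs.mem_closure_of_mem_leftInversions hab ht
  have htp : t * p ∈ g • (Subgroup.closure (cs.simple '' T) : Set W) := by
    rw [Set.mem_smul_set_iff_inv_smul_mem, SetLike.mem_coe, smul_eq_mul]
    simpa [mul_assoc] using mul_mem (mul_mem (mul_mem ha hta) (inv_mem ha)) hpC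
  have hle := hmin _ htp
  simp only [CoxAux.dist] at hle
  have : v⁻¹ * t * v * (v⁻¹ * p) = v⁻¹ * (t * p) := by group
  rw [this] at hlt
  omega

theorem nearestPoints_nonempty (v : W) {C : Set W} (hC : C.Nonempty) :
    (nearestPoints cs v C).Nonempty := by
  obtain ⟨p, hp, hmin⟩ := (measure (CoxAux.dist cs v)).wf.has_min C hC
  exact ⟨p, hp, fun q hq ↦ not_lt.mp (hmin q hq)⟩

/-- Nearest points in the projection of `g W_T` to `h W_T'` depend only on the projection to
`g W_T`. -/
theorem nearestPoints_iUnion_subset {T T' : Set B} {g h v₁ v₂ p : W}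
    (h₁ : p ∈ nearestPoints cs v₁ (g • (Subgroup.closure (cs.simple '' T) : Set W)))
    (h₂ : p ∈ nearestPoints cs v₂ (g • (Subgroup.closure (cs.simple '' T) : Set W))) :
    nearestPoints cs v₁ (⋃ x ∈ g • (Subgroup.closure (cs.simple '' T) : Set W),
        nearestPoints cs x (h • (Subgroup.closure (cs.simple '' T') : Set W))) ⊆
      nearestPoints cs v₂ (⋃ x ∈ g • (Subgroup.closure (cs.simple '' T) : Set W),
        nearestPoints cs x (h • (Subgroup.closure (cs.simple '' T') : Set W))) := by
  rintro y ⟨hy, hmin⟩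
  refine ⟨hy, fun y' hy' ↦ ?_⟩
  have hle := hmin y' hy'
  simp only [Set.mem_iUnion, exists_prop] at hy hy'
  obtain ⟨x, hx, hxy⟩ := hy
  obtain ⟨x', hx', hxy'⟩ := hy'
  rw [dist_eq_card_symmDiff, dist_eq_card_symmDiff] at hle ⊢
  refine Finset.card_symmDiff_le_of_agree (fun t ht ↦ ?_) hle
  have e := cs.mem_leftInversions_iff_of_mem_nearestPoints hxy.1 hxy'.1 hxy ht
  have e' := cs.mem_leftInversions_iff_of_mem_nearestPoints hxy.1 hxy'.1 hxy' ht
  have htx : t ∈ symmDiff (cs.leftInversions x) (cs.leftInversions x') := by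
    rw [Finset.mem_symmDiff] at ht ⊢
    rwa [e, e']
  exact (cs.mem_leftInversions_iff_of_mem_nearestPoints hx hx' h₁ htx).trans
    (cs.mem_leftInversions_iff_of_mem_nearestPoints hx hx' h₂ htx).symm

end CoxeterSystem

/-- Let `(W, S)` be a Coxeter system, `T, T' ⊆ S` with the standard parabolic subgroup `W_T`
finite, `E = g W_T` and `F = h W_{T'}` left cosets, and `E' = ⋃_{x ∈ E} Proj(x, F)`. If
`v₁, v₂ ∈ W` have the same nearest-point projection to `E`, then they have the same
nearest-point projection to `E'`. -/
theorem nearestPoints_union_eq_of_nearestPoints_eq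
    {B : Type*} {W : Type*} [Group W] {M : CoxeterMatrix B}
    (cs : CoxeterSystem M W) (T T' : Set B)
    (hfin : Finite (Subgroup.closure (cs.simple '' T)))
    (g h : W) (E F E' : Set W)
    (hE : E = g • (Subgroup.closure (cs.simple '' T) : Set W))
    (hF : F = h • (Subgroup.closure (cs.simple '' T') : Set W))
    (hE' : E' = ⋃ x ∈ E, nearestPoints cs x F)
    (v₁ v₂ : W)
    (hv : nearestPoints cs v₁ E = nearestPoints cs v₂ E) :
    nearestPoints cs v₁ E' = nearestPoints cs v₂ E' := by
  subst hE hF hE'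
  obtain ⟨p, hp⟩ := cs.nearestPoints_nonempty v₁
    (C := g • (Subgroup.closure (cs.simple '' T) : Set W)) ⟨g, 1, one_mem _, mul_one g⟩
  have hp' := hv ▸ hp
  exact (cs.nearestPoints_iUnion_subset hp hp').antisymm
    (cs.nearestPoints_iUnion_subset hp' hp)
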